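/- arXiv:1904.12955 — 2 statements merged into one kernel-verified Lean document; each statement's English description precedes it below -/
import Mathlib

section
/- The 2n unordered pairs {v, A-partner of v} and {v, B-partner of v}, as v ranges over the n vertices with μ(v) = −1, are pairwise distinct; hence the graph G(μ) has exactly 2n edges. -/
open Finset

/-- The open counterclockwise arc `{v+1, …, v+(k-1)}` (indexed by `i = 1,…,k-1`) is
balanced: it contains as many elements where `μ = 1` as elements where `μ = -1`. -/
def ArcBalanced (n : ℕ) (μ : ZMod (2*n+1) → ℤ) (v : ZMod (2*n+1)) (k : ℕ) : Prop :=
  ((Finset.Icc 1 (k-1)).filter fun i : ℕ => μ (v + (i : ZMod (2*n+1))) = 1).card =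
  ((Finset.Icc 1 (k-1)).filter fun i : ℕ => μ (v + (i : ZMod (2*n+1))) = -1).card

/-- `k` is a valid cancellation length for an `A`-band at `v`:
`μ (v+k) = 1` and the open arc `{v+1, …, v+(k-1)}` is balanced. -/
def AGood (n : ℕ) (μ : ZMod (2*n+1) → ℤ) (v : ZMod (2*n+1)) (k : ℕ) : Prop :=
  μ (v + (k : ZMod (2*n+1))) = 1 ∧ ArcBalanced n μ v k

/-- `k` is a valid cancellation length for a `B`-band at `v`:
`μ (v-k) = 1` and the open arc `{v-k+1, …, v-1}` is balanced. -/
def BGood (n : ℕ) (μ : ZMod (2*n+1) → ℤ) (v : ZMod (2*n+1)) (k : ℕ) : Prop :=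
  μ (v - (k : ZMod (2*n+1))) = 1 ∧ ArcBalanced n μ (v - (k : ZMod (2*n+1))) k

/-- `w` is the `A`-partner of `v`: `w = v + k` for the least `k ∈ {1,…,2n}` with
`μ (v+k) = 1` and the open arc `{v+1,…,v+(k-1)}` balanced. -/
def IsAPartner (n : ℕ) (μ : ZMod (2*n+1) → ℤ) (v w : ZMod (2*n+1)) : Prop :=
  ∃ k ∈ Finset.Icc 1 (2*n), AGood n μ v k ∧
    (∀ j ∈ Finset.Icc 1 (2*n), j < k → ¬ AGood n μ v j) ∧ w = v + (k : ZMod (2*n+1))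

/-- `w` is the `B`-partner of `v`: `w = v - k` for the least `k ∈ {1,…,2n}` with
`μ (v-k) = 1` and the open arc `{v-k+1,…,v-1}` balanced. -/
def IsBPartner (n : ℕ) (μ : ZMod (2*n+1) → ℤ) (v w : ZMod (2*n+1)) : Prop :=
  ∃ k ∈ Finset.Icc 1 (2*n), BGood n μ v k ∧
    (∀ j ∈ Finset.Icc 1 (2*n), j < k → ¬ BGood n μ v j) ∧ w = v - (k : ZMod (2*n+1))

/-- The auxiliary graph `G(μ)`: its edges are exactly the unordered pairs
`{v, A-partner of v}` and `{v, B-partner of v}` over all `v` with `μ v = -1`. -/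
def G (n : ℕ) (μ : ZMod (2*n+1) → ℤ) : SimpleGraph (ZMod (2*n+1)) :=
  SimpleGraph.fromRel fun x y => μ x = -1 ∧ (IsAPartner n μ x y ∨ IsBPartner n μ x y)

noncomputable instance {n : ℕ} {μ : ZMod (2*n+1) → ℤ} {v : ZMod (2*n+1)} :
    Fintype ((G n μ).neighborSet v) := Fintype.ofFinite _

/-- The sum of `μ` over the `k` consecutive vertices `v, v+1, …, v+(k-1)`. -/
def arcSum (n : ℕ) (μ : ZMod (2*n+1) → ℤ) (v : ZMod (2*n+1)) (k : ℕ) : ℤ :=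
  ∑ i ∈ Finset.range k, μ (v + (i : ZMod (2*n+1)))

section

variable {n : ℕ} {μ : ZMod (2*n+1) → ℤ}

theorem card_filter_sub_card_filter {ι : Type*} (s : Finset ι) (f : ι → ℤ)
    (hf : ∀ i, f i = 1 ∨ f i = -1) :
    ((s.filter fun i => f i = 1).card : ℤ) - ((s.filter fun i => f i = -1).card : ℤ) =
      ∑ i ∈ s, f i := by
  rw [Finset.card_filter, Finset.card_filter]
  push_cast
  rw [← Finset.sum_sub_distrib]
  refine Finset.sum_congr rfl fun i _ => ?_
  rcases hf i with h | h <;> simp [h]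

theorem arcSum_succ (v : ZMod (2*n+1)) (k : ℕ) :
    arcSum n μ v (k+1) = arcSum n μ v k + μ (v + (k : ZMod (2*n+1))) := by
  simp [arcSum, Finset.sum_range_succ]

theorem arcSum_add (v : ZMod (2*n+1)) (k l : ℕ) :
    arcSum n μ v (k+l) = arcSum n μ v k + arcSum n μ (v + (k : ZMod (2*n+1))) l := by
  simp [arcSum, Finset.sum_range_add, add_assoc]

theorem arcSum_succ' (v : ZMod (2*n+1)) (k : ℕ) :
    arcSum n μ v (k+1) = μ v + arcSum n μ (v+1) k := by
  rw [add_comm k 1, arcSum_add]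
  simp [arcSum]

theorem arcSum_full (v : ZMod (2*n+1)) : arcSum n μ v (2*n+1) = ∑ x, μ x := by
  rw [← Equiv.sum_comp (Equiv.addLeft v) μ]
  refine Finset.sum_bij' (fun i _ => (i : ZMod (2*n+1))) (fun x _ => x.val) ?_ ?_ ?_ ?_ ?_
  · simp
  · intro x _
    exact Finset.mem_range.2 (ZMod.val_lt x)
  · intro i hi
    exact ZMod.val_cast_of_lt (Finset.mem_range.1 hi)
  · intro x _
    exact ZMod.natCast_zmod_val x
  · simp

theorem arcBalanced_succ_iff (hval : ∀ v, μ v = 1 ∨ μ v = -1) (v : ZMod (2*n+1)) (k : ℕ) :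
    ArcBalanced n μ v (k+1) ↔ arcSum n μ (v+1) k = 0 := by
  have h := card_filter_sub_card_filter (Finset.Icc 1 k)
    (fun i : ℕ => μ (v + (i : ZMod (2*n+1)))) fun _ => hval _
  have h' : arcSum n μ (v+1) k = ∑ i ∈ Finset.Icc 1 k, μ (v + (i : ZMod (2*n+1))) := by
    rw [arcSum, Finset.range_eq_Ico,
      ← Finset.Ico_add_one_right_eq_Icc, Finset.sum_Ico_eq_sum_range, Finset.sum_Ico_eq_sum_range]
    simp [add_assoc]
  rw [h', ← h, sub_eq_zero, Nat.cast_inj]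
  rfl

theorem aGood_succ_iff (hval : ∀ v, μ v = 1 ∨ μ v = -1) (v : ZMod (2*n+1)) (k : ℕ) :
    AGood n μ v (k+1) ↔
      μ (v + ((k+1 : ℕ) : ZMod (2*n+1))) = 1 ∧ arcSum n μ (v+1) k = 0 := by
  rw [AGood, arcBalanced_succ_iff hval]

theorem aGood_iff (hval : ∀ v, μ v = 1 ∨ μ v = -1) {v : ZMod (2*n+1)} (hv : μ v = -1)
    {k : ℕ} (hk : 1 ≤ k) :
    AGood n μ v k ↔ μ (v + (k : ZMod (2*n+1))) = 1 ∧ arcSum n μ v k = -1 := by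
  obtain ⟨k, rfl⟩ := Nat.exists_eq_add_of_le' hk
  rw [aGood_succ_iff hval, arcSum_succ', hv]
  refine and_congr_right fun _ => ?_
  omega

theorem bGood_iff_aGood_neg (hval : ∀ v, μ v = 1 ∨ μ v = -1) (v : ZMod (2*n+1))
    {k : ℕ} (hk : 1 ≤ k) :
    BGood n μ v k ↔ AGood n (fun x => μ (-x)) (-v) k := by
  obtain ⟨k, rfl⟩ := Nat.exists_eq_add_of_le' hk
  rw [aGood_succ_iff fun x => hval (-x), BGood, arcBalanced_succ_iff hval]
  have h : arcSum n (fun x => μ (-x)) (-v+1) k =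
      arcSum n μ (v - ((k+1 : ℕ) : ZMod (2*n+1)) + 1) k := by
    rw [arcSum, arcSum, ← Finset.sum_range_reflect]
    refine Finset.sum_congr rfl fun i hi => ?_
    have hi' := Finset.mem_range.1 hi
    rw [Nat.sub_sub, Nat.cast_sub (by omega)]
    congr 1
    push_cast
    ring
  rw [h, show -(-v + ((k+1 : ℕ) : ZMod (2*n+1))) = v - ((k+1 : ℕ) : ZMod (2*n+1)) by ring]

theorem isBPartner_iff_isAPartner_neg (hval : ∀ v, μ v = 1 ∨ μ v = -1)
    (v w : ZMod (2*n+1)) :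
    IsBPartner n μ v w ↔ IsAPartner n (fun x => μ (-x)) (-v) (-w) := by
  refine exists_congr fun k => and_congr_right fun hk => ?_
  rw [bGood_iff_aGood_neg hval v (Finset.mem_Icc.1 hk).1]
  refine and_congr_right fun _ => and_congr ?_ ?_
  · refine forall₂_congr fun j hj => ?_
    rw [bGood_iff_aGood_neg hval v (Finset.mem_Icc.1 hj).1]
  · rw [neg_eq_iff_eq_neg, neg_add, neg_neg, sub_eq_add_neg]

/-- A walk leaving a negative vertex that has climbed back to height `0` within `m` steps passes
an admissible cancellation length on the way. -/
theorem exists_aGood_of_arcSum_nonneg (hval : ∀ v, μ v = 1 ∨ μ v = -1) {v : ZMod (2*n+1)}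
    (hv : μ v = -1) (m : ℕ) (hm : 1 ≤ m) (h : 0 ≤ arcSum n μ v m) :
    ∃ k, 1 ≤ k ∧ k < m ∧ AGood n μ v k := by
  induction m, hm using Nat.le_induction with
  | base =>
    simp [arcSum, hv] at h
  | succ m hm ih =>
    by_cases hlt : 0 ≤ arcSum n μ v m
    · obtain ⟨k, h1, h2, h3⟩ := ih hlt
      exact ⟨k, h1, by omega, h3⟩
    · rw [arcSum_succ] at h
      refine ⟨m, hm, by omega, (aGood_iff hval hv hm).2 ?_⟩
      rcases hval (v + (m : ZMod (2*n+1))) with h' | h' <;> omega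

theorem exists_isAPartner (hval : ∀ v, μ v = 1 ∨ μ v = -1) (hsum : ∑ x, μ x = 1)
    {v : ZMod (2*n+1)} (hv : μ v = -1) : ∃ w, IsAPartner n μ v w := by
  classical
  have hex : ∃ k, 1 ≤ k ∧ k < 2*n+1 ∧ AGood n μ v k :=
    exists_aGood_of_arcSum_nonneg hval hv _ (by omega) (by rw [arcSum_full, hsum]; omega)
  obtain ⟨h1, h2, h3⟩ := Nat.find_spec hex
  refine ⟨_, Nat.find hex, Finset.mem_Icc.2 ⟨h1, by omega⟩, h3, fun j hj hlt hg => ?_, rfl⟩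
  exact Nat.find_min hex hlt ⟨(Finset.mem_Icc.1 hj).1, by omega, hg⟩

theorem IsAPartner.unique {v w w' : ZMod (2*n+1)} (h : IsAPartner n μ v w)
    (h' : IsAPartner n μ v w') : w = w' := by
  obtain ⟨k, hk, hg, hmin, rfl⟩ := h
  obtain ⟨k', hk', hg', hmin', rfl⟩ := h'
  rcases lt_trichotomy k k' with hlt | rfl | hlt
  · exact absurd hg (hmin' k hk hlt)
  · rfl
  · exact absurd hg' (hmin k' hk' hlt)

theorem IsAPartner.apply_eq_one {v w : ZMod (2*n+1)} (h : IsAPartner n μ v w) : μ w = 1 := by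
  obtain ⟨k, -, hg, -, rfl⟩ := h
  exact hg.1

theorem exists_isBPartner (hval : ∀ v, μ v = 1 ∨ μ v = -1) (hsum : ∑ x, μ x = 1)
    {v : ZMod (2*n+1)} (hv : μ v = -1) : ∃ w, IsBPartner n μ v w := by
  obtain ⟨w, hw⟩ := exists_isAPartner (μ := fun x => μ (-x)) (v := -v) (fun x => hval (-x))
    (by rw [← hsum]; exact Equiv.sum_comp (Equiv.neg _) μ) (by simpa using hv)
  exact ⟨-w, (isBPartner_iff_isAPartner_neg hval v (-w)).2 (by rwa [neg_neg])⟩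

theorem IsBPartner.unique (hval : ∀ v, μ v = 1 ∨ μ v = -1) {v w w' : ZMod (2*n+1)}
    (h : IsBPartner n μ v w) (h' : IsBPartner n μ v w') : w = w' := by
  rw [isBPartner_iff_isAPartner_neg hval] at h h'
  exact neg_injective (h.unique h')

theorem IsBPartner.apply_eq_one {v w : ZMod (2*n+1)} (h : IsBPartner n μ v w) : μ w = 1 := by
  obtain ⟨k, -, hg, -, rfl⟩ := h
  exact hg.1

/-- The arcs to a common `A`- and `B`-partner would cover the cycle with total sum `0`. -/
theorem IsAPartner.not_isBPartner (hval : ∀ v, μ v = 1 ∨ μ v = -1) (hsum : ∑ x, μ x = 1)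
    {v w : ZMod (2*n+1)} (hv : μ v = -1) (h : IsAPartner n μ v w) : ¬ IsBPartner n μ v w := by
  rintro ⟨l, hl, hB, -, hw'⟩
  obtain ⟨k, hk, hA, -, hw⟩ := h
  rw [Finset.mem_Icc] at hk hl
  have hz : ((k + l : ℕ) : ZMod (2*n+1)) = 0 := by
    push_cast
    linear_combination hw' - hw
  obtain ⟨c, hc⟩ := (ZMod.natCast_eq_zero_iff _ _).1 hz
  have hc1 : c = 1 := by
    have h0 : c ≠ 0 := by
      rintro rfl
      omega
    have h2 : c < 2 := by
      by_contra! h2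
      have := Nat.mul_le_mul_left (2*n+1) h2
      omega
    omega
  subst hc1
  have hA' := (aGood_iff hval hv hk.1).1 hA
  obtain ⟨l, rfl⟩ := Nat.exists_eq_add_of_le' hl.1
  have hB' := (arcBalanced_succ_iff hval _ _).1 hB.2
  rw [← hw', hw] at hB'
  have hfull := arcSum_full (μ := μ) v
  have hlen : arcSum n μ v (2*n+1) = arcSum n μ v (k + (l+1)) := congrArg _ (by omega)
  rw [hlen, arcSum_add, arcSum_succ', hA'.1, hA'.2, hB', hsum] at hfull
  omega

end

theorem edges_pairwise_distinct_card (n : ℕ) (μ : ZMod (2*n+1) → ℤ)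
    (hn : 0 < n)
    (hval : ∀ v, μ v = 1 ∨ μ v = -1)
    (hplus : (Finset.univ.filter fun v : ZMod (2*n+1) => μ v = 1).card = n + 1)
    (hminus : (Finset.univ.filter fun v : ZMod (2*n+1) => μ v = -1).card = n) :
    (∀ v v' w w' : ZMod (2*n+1), μ v = -1 → μ v' = -1 →
      ((IsAPartner n μ v w ∧ IsAPartner n μ v' w') ∨ (IsBPartner n μ v w ∧ IsBPartner n μ v' w')) →
      s(v, w) = s(v', w') → v = v') ∧
    (∀ v v' w w' : ZMod (2*n+1), μ v = -1 → μ v' = -1 →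
      IsAPartner n μ v w → IsBPartner n μ v' w' → s(v, w) ≠ s(v', w')) ∧
    (G n μ).edgeSet.ncard = 2*n := by
  have hsum : ∑ x, μ x = 1 := by
    have h := card_filter_sub_card_filter Finset.univ μ hval
    rw [hplus, hminus] at h
    push_cast at h
    omega
  have hpair : ∀ {v v' w w' : ZMod (2*n+1)}, μ v = -1 → μ w' = 1 →
      s(v, w) = s(v', w') → v = v' ∧ w = w' := by
    intro v v' w w' hv hw' h
    rcases Sym2.eq_iff.1 h with h | ⟨rfl, -⟩
    · exact h
    · omega
  have hinj : ∀ v v' w w' : ZMod (2*n+1), μ v = -1 → μ v' = -1 →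
      ((IsAPartner n μ v w ∧ IsAPartner n μ v' w') ∨ (IsBPartner n μ v w ∧ IsBPartner n μ v' w')) →
      s(v, w) = s(v', w') → v = v' := by
    rintro v v' w w' hv hv' (⟨h, h'⟩ | ⟨h, h'⟩) heq
    · exact (hpair hv h'.apply_eq_one heq).1
    · exact (hpair hv h'.apply_eq_one heq).1
  have hne : ∀ v v' w w' : ZMod (2*n+1), μ v = -1 → μ v' = -1 →
      IsAPartner n μ v w → IsBPartner n μ v' w' → s(v, w) ≠ s(v', w') := by
    intro v v' w w' hv hv' h h' heq
    obtain ⟨rfl, rfl⟩ := hpair hv h'.apply_eq_one heq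
    exact h.not_isBPartner hval hsum hv h'
  refine ⟨hinj, hne, ?_⟩
  choose! a ha using fun v (hv : μ v = -1) => exists_isAPartner hval hsum hv
  choose! b hb using fun v (hv : μ v = -1) => exists_isBPartner hval hsum hv
  have hcard : {v | μ v = -1}.ncard = n := by
    refine Eq.trans ?_ hminus
    rw [← Set.ncard_coe_finset]
    simp
  have hedge : (G n μ).edgeSet =
      (fun v => s(v, a v)) '' {v | μ v = -1} ∪ (fun v => s(v, b v)) '' {v | μ v = -1} := by
    have hrel : ∀ x y, μ x = -1 ∧ (IsAPartner n μ x y ∨ IsBPartner n μ x y) ↔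
        μ x = -1 ∧ (a x = y ∨ b x = y) := by
      refine fun x y => and_congr_right fun hx => or_congr ?_ ?_
      · exact ⟨(ha x hx).unique, fun h => h ▸ ha x hx⟩
      · exact ⟨(hb x hx).unique hval, fun h => h ▸ hb x hx⟩
    have hxy : ∀ x y, μ x = -1 ∧ (a x = y ∨ b x = y) → x ≠ y := by
      rintro x _ ⟨hx, rfl | rfl⟩ h
      · have := (ha x hx).apply_eq_one
        rw [← h] at this
        omega
      · have := (hb x hx).apply_eq_one
        rw [← h] at this
        omega
    ext e
    induction e with | _ x y
    simp only [SimpleGraph.mem_edgeSet, G, SimpleGraph.fromRel_adj, hrel, Set.mem_union,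
      Set.mem_image, Set.mem_ofPred_eq, Sym2.eq_iff]
    constructor
    · rintro ⟨-, ⟨hx, h | h⟩ | ⟨hx, h | h⟩⟩
      · exact Or.inl ⟨x, hx, Or.inl ⟨rfl, h⟩⟩
      · exact Or.inr ⟨x, hx, Or.inl ⟨rfl, h⟩⟩
      · exact Or.inl ⟨y, hx, Or.inr ⟨rfl, h⟩⟩
      · exact Or.inr ⟨y, hx, Or.inr ⟨rfl, h⟩⟩
    · have key : ∀ x y, μ x = -1 ∧ (a x = y ∨ b x = y) →
          x ≠ y ∧ ((μ x = -1 ∧ (a x = y ∨ b x = y)) ∨ (μ y = -1 ∧ (a y = x ∨ b y = x))) :=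
        fun x y h => ⟨hxy x y h, Or.inl h⟩
      rintro (⟨v, hv, ⟨rfl, h⟩ | ⟨rfl, h⟩⟩ | ⟨v, hv, ⟨rfl, h⟩ | ⟨rfl, h⟩⟩)
      · exact key _ _ ⟨hv, Or.inl h⟩
      · exact (key _ _ ⟨hv, Or.inl h⟩).imp Ne.symm Or.symm
      · exact key _ _ ⟨hv, Or.inr h⟩
      · exact (key _ _ ⟨hv, Or.inr h⟩).imp Ne.symm Or.symm
  rw [hedge, Set.ncard_union_eq _ (Set.toFinite _) (Set.toFinite _), Set.InjOn.ncard_image,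
    Set.InjOn.ncard_image, hcard, two_mul]
  · exact fun v hv v' hv' h => hinj _ _ _ _ hv hv' (Or.inr ⟨hb v hv, hb v' hv'⟩) h
  · exact fun v hv v' hv' h => hinj _ _ _ _ hv hv' (Or.inl ⟨ha v hv, ha v' hv'⟩) h
  · rw [Set.disjoint_left]
    rintro _ ⟨v, hv, rfl⟩ ⟨v', hv', h⟩
    exact hne v v' _ _ hv hv' (ha v hv) (hb v' hv') h.symm
end

section
/- The graph G(μ) is acyclic: it contains no cycle. -/
open Finset

/-- The height at `i : ℤ` of the lattice walk whose step from `i` to `i + 1` is `μ i`, for `μ` of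
total sum `1`. -/
def height (n : ℕ) (μ : ZMod (2*n+1) → ℤ) (i : ℤ) : ℤ :=
  i / (2*n+1) + ∑ j ∈ Finset.range (i % (2*n+1)).toNat, μ (j : ZMod (2*n+1))

/-- The lower endpoint height of the step of the walk from `i` to `i + 1`. -/
def level (n : ℕ) (μ : ZMod (2*n+1) → ℤ) (i : ℤ) : ℤ :=
  min (height n μ i) (height n μ (i + 1))

/-- The lift of `v` to `ℤ` at which the step of the walk has level `0`. -/
def position (n : ℕ) (μ : ZMod (2*n+1) → ℤ) (v : ZMod (2*n+1)) : ℤ :=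
  v.val - (2*n+1) * level n μ v.val

section Walk

variable {n : ℕ} {μ : ZMod (2*n+1) → ℤ}

theorem sum_eq_card_sub_card {ι : Type*} (s : Finset ι) (f : ι → ℤ)
    (hf : ∀ i, f i = 1 ∨ f i = -1) :
    ∑ i ∈ s, f i = ((s.filter fun i => f i = 1).card : ℤ) - (s.filter fun i => f i = -1).card := by
  rw [Finset.card_filter, Finset.card_filter]
  push_cast
  rw [← Finset.sum_sub_distrib]
  refine Finset.sum_congr rfl fun i _ => ?_
  rcases hf i with h | h <;> simp [h]

theorem height_add_mul_period (i m : ℤ) :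
    height n μ (i + (2*n+1) * m) = height n μ i + m := by
  have h : (2*n+1 : ℤ) ≠ 0 := by omega
  rw [height, height, Int.add_mul_ediv_left _ _ h, Int.add_mul_emod_self_left]
  ring

theorem level_add_mul_period (i m : ℤ) :
    level n μ (i + (2*n+1) * m) = level n μ i + m := by
  rw [level, level, add_right_comm, height_add_mul_period, height_add_mul_period,
    min_add_add_right]

theorem sum_range_natCast (μ : ZMod (2*n+1) → ℤ) :
    ∑ j ∈ Finset.range (2*n+1), μ (j : ZMod (2*n+1)) = ∑ v, μ v := by
  refine Finset.sum_bij' (fun j _ => (j : ZMod (2*n+1))) (fun v _ => v.val) ?_ ?_ ?_ ?_ ?_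
  · simp
  · exact fun v _ => Finset.mem_range.2 (ZMod.val_lt v)
  · exact fun j hj => ZMod.val_cast_of_lt (Finset.mem_range.1 hj)
  · simp
  · simp

theorem height_add_one (hsum : ∑ v, μ v = 1) (i : ℤ) :
    height n μ (i + 1) = height n μ i + μ (i : ZMod (2*n+1)) := by
  obtain ⟨r, m, hr, rfl⟩ : ∃ (r : ℕ) (m : ℤ), r < 2*n+1 ∧ i = r + (2*n+1) * m := by
    have h0 := Int.emod_nonneg i (b := 2*n+1) (by omega)
    have h1 := Int.emod_lt_of_pos i (b := 2*n+1) (by omega)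
    have h2 := Int.emod_add_mul_ediv i (2*n+1)
    refine ⟨(i % (2*n+1)).toNat, i / (2*n+1), by omega, ?_⟩
    rw [Int.toNat_of_nonneg h0, h2]
  have hN : ((2*n+1 : ℤ) : ZMod (2*n+1)) = 0 := by
    exact_mod_cast ZMod.natCast_self (2*n+1)
  have hsmall : ∀ s : ℕ, s < 2*n+1 →
      height n μ s = ∑ j ∈ Finset.range s, μ (j : ZMod (2*n+1)) := by
    intro s hs
    rw [height, Int.ediv_eq_zero_of_lt (by omega) (by omega),
      Int.emod_eq_of_lt (by omega) (by omega)]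
    simp
  have hcast : (((r : ℤ) + (2*n+1) * m : ℤ) : ZMod (2*n+1)) = (r : ZMod (2*n+1)) := by
    rw [Int.cast_add, Int.cast_mul, hN]
    simp
  rw [hcast, add_right_comm, height_add_mul_period, height_add_mul_period, hsmall r hr]
  suffices h : height n μ ((r : ℤ) + 1) = ∑ j ∈ Finset.range (r+1), μ (j : ZMod (2*n+1)) by
    rw [h, Finset.sum_range_succ]
    ring
  rcases Nat.lt_or_ge (r+1) (2*n+1) with h | h
  · exact_mod_cast hsmall (r+1) h
  · obtain rfl : r = 2*n := by omega
    rw [sum_range_natCast, hsum]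
    have h0 := height_add_mul_period (n := n) (μ := μ) 0 1
    have h1 := hsmall 0 (by omega)
    simp only [Nat.cast_zero, Finset.range_zero, Finset.sum_empty] at h1
    rw [h1] at h0
    push_cast
    simpa using h0

theorem height_add_sub_height (hsum : ∑ v, μ v = 1) (i : ℤ) (k : ℕ) :
    height n μ (i + (k + 1 : ℕ)) - height n μ (i + 1) =
      ∑ j ∈ Finset.Icc 1 k, μ ((i : ZMod (2*n+1)) + (j : ZMod (2*n+1))) := by
  induction k with
  | zero => simp
  | succ k ih =>
    rw [Finset.sum_Icc_succ_top (by omega), ← ih]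
    have := height_add_one hsum (i + (k + 1 : ℕ))
    push_cast at this ⊢
    rw [← add_assoc i, this]
    ring

theorem arcBalanced_iff_height_eq (hval : ∀ v, μ v = 1 ∨ μ v = -1) (hsum : ∑ v, μ v = 1)
    (i : ℤ) {k : ℕ} (hk : 1 ≤ k) :
    ArcBalanced n μ (i : ZMod (2*n+1)) k ↔ height n μ (i + k) = height n μ (i + 1) := by
  obtain ⟨k, rfl⟩ := Nat.exists_eq_add_of_le' hk
  have h := height_add_sub_height hsum i k
  rw [sum_eq_card_sub_card _ _ fun j => hval _] at h
  rw [ArcBalanced, Nat.add_sub_cancel]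
  omega

theorem position_cast (v : ZMod (2*n+1)) : (position n μ v : ZMod (2*n+1)) = v := by
  have hN : ((2*n+1 : ℤ) : ZMod (2*n+1)) = 0 := by
    exact_mod_cast ZMod.natCast_self (2*n+1)
  rw [position, Int.cast_sub, Int.cast_mul, hN]
  simp

theorem level_position (v : ZMod (2*n+1)) : level n μ (position n μ v) = 0 := by
  rw [position, sub_eq_add_neg, ← mul_neg, level_add_mul_period]
  ring

theorem position_injective : Function.Injective (position n μ) :=
  Function.LeftInverse.injective (g := fun i : ℤ => (i : ZMod (2*n+1))) position_cast

theorem position_intCast {i : ℤ} (hi : level n μ i = 0) :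
    position n μ (i : ZMod (2*n+1)) = i := by
  have h : ((position n μ (i : ZMod (2*n+1)) : ℤ) : ZMod (2*n+1)) = i := position_cast _
  rw [eq_comm, ZMod.intCast_eq_intCast_iff_dvd_sub] at h
  obtain ⟨m, hm⟩ := h
  have hp : position n μ (i : ZMod (2*n+1)) = i + (2*n+1) * m := by
    push_cast at hm
    linarith
  have hl := level_position (μ := μ) (i : ZMod (2*n+1))
  rw [hp, level_add_mul_period, hi] at hl
  rw [hp, show m = 0 by omega]
  ring

theorem height_position (hsum : ∑ v, μ v = 1) {v : ZMod (2*n+1)} (hv : μ v = -1) :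
    height n μ (position n μ v) = 1 ∧ height n μ (position n μ v + 1) = 0 := by
  have h := height_add_one hsum (position n μ v)
  have hl := level_position (μ := μ) v
  rw [position_cast, hv] at h
  rw [level] at hl
  omega

theorem IsAPartner.position_covBy (hval : ∀ v, μ v = 1 ∨ μ v = -1) (hsum : ∑ v, μ v = 1)
    {v w : ZMod (2*n+1)} (hv : μ v = -1) (h : IsAPartner n μ v w) :
    position n μ v < position n μ w ∧
      ∀ u, position n μ v < position n μ u → position n μ w ≤ position n μ u := by
  obtain ⟨k, hk, ⟨hup, hbal⟩, hmin, rfl⟩ := h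
  rw [Finset.mem_Icc] at hk
  obtain ⟨h1, h0⟩ := height_position hsum hv
  have hvc := position_cast (μ := μ) v
  set i := position n μ v
  rw [← hvc] at hup hbal hmin ⊢
  rw [arcBalanced_iff_height_eq hval hsum i hk.1, h0] at hbal
  have hstep := height_add_one hsum
  have hup' := hstep (i + k)
  push_cast at hup'
  rw [hup, hbal] at hup'
  have hpos : position n μ ((i : ZMod (2*n+1)) + k) = i + k := by
    have := position_intCast (n := n) (μ := μ) (i := i + k) (by rw [level]; omega)
    push_cast at this
    exact this
  have hle : ∀ j : ℕ, 1 ≤ j → j ≤ k → height n μ (i + j) ≤ 0 := by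
    intro j hj
    induction j, hj using Nat.le_induction with
    | base => intro; push_cast; omega
    | succ j hj ih =>
      intro hjk
      have hA := hmin j (Finset.mem_Icc.2 ⟨hj, by omega⟩) (by omega)
      rw [AGood, arcBalanced_iff_height_eq hval hsum i hj, h0] at hA
      have hs := hstep (i + j)
      push_cast at hs ⊢
      rw [← add_assoc]
      have := ih (by omega)
      rcases hval ((i : ZMod (2*n+1)) + j) with hu | hu
      · have : height n μ (i + j) ≠ 0 := fun h => hA ⟨hu, h⟩
        omega
      · omega
  rw [hpos]
  refine ⟨by omega, fun u hu => ?_⟩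
  by_contra! hlt
  have hl := level_position (μ := μ) u
  obtain ⟨j, hj⟩ := Int.eq_ofNat_of_zero_le (show 0 ≤ position n μ u - i by omega)
  have hju : position n μ u = i + j := by omega
  rw [hju, level] at hl
  have ha := hle j (by omega) (by omega)
  have hb := hle (j + 1) (by omega) (by omega)
  have hs := hstep (i + j)
  push_cast at hb hs
  rw [← add_assoc] at hb
  rcases hval ((i : ZMod (2*n+1)) + j) with hu | hu <;> omega

theorem IsBPartner.position_covBy (hval : ∀ v, μ v = 1 ∨ μ v = -1) (hsum : ∑ v, μ v = 1)
    {v w : ZMod (2*n+1)} (hv : μ v = -1) (h : IsBPartner n μ v w) :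
    position n μ w < position n μ v ∧
      ∀ u, position n μ w < position n μ u → position n μ v ≤ position n μ u := by
  obtain ⟨k, hk, ⟨hup, hbal⟩, hmin, rfl⟩ := h
  rw [Finset.mem_Icc] at hk
  obtain ⟨h1, h0⟩ := height_position hsum hv
  have hvc := position_cast (μ := μ) v
  set i := position n μ v
  have hcast : ∀ j : ℕ, (i : ZMod (2*n+1)) - j = ((i - j : ℤ) : ZMod (2*n+1)) := by
    intro j
    push_cast
    rfl
  have hstep := height_add_one hsum
  rw [← hvc] at hup hbal hmin ⊢
  rw [hcast] at hup hbal ⊢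
  rw [arcBalanced_iff_height_eq hval hsum _ hk.1, sub_add_cancel, h1] at hbal
  have hup' := hstep (i - k)
  rw [hup] at hup'
  rw [position_intCast (by rw [level]; omega)]
  have hle : ∀ j : ℕ, j < k → 1 ≤ height n μ (i - j) := by
    intro j
    induction j with
    | zero => intro; simp [h1]
    | succ j ih =>
      intro hjk
      have hB := hmin (j + 1) (Finset.mem_Icc.2 ⟨by omega, by omega⟩) hjk
      rw [BGood, hcast, arcBalanced_iff_height_eq hval hsum _ (by omega), sub_add_cancel, h1] at hB
      have hs := hstep (i - (j + 1 : ℕ))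
      have hj := ih (by omega)
      have he : i - (j + 1 : ℕ) + 1 = i - j := by push_cast; ring
      rw [he] at hs hB
      rcases hval ((i - (j + 1 : ℕ) : ℤ) : ZMod (2*n+1)) with hu | hu
      · have : 1 ≠ height n μ (i - j) := fun h => hB ⟨hu, h⟩
        omega
      · omega
  refine ⟨by omega, fun u hu => ?_⟩
  by_contra! hlt
  have hl := level_position (μ := μ) u
  obtain ⟨j, hj⟩ := Int.eq_ofNat_of_zero_le (show 0 ≤ i - position n μ u - 1 by omega)
  have hju : position n μ u = i - (j + 1 : ℕ) := by omega
  have he : i - (j + 1 : ℕ) + 1 = i - j := by push_cast; ring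
  rw [hju, level, he] at hl
  have ha := hle j (by omega)
  have hb := hle (j + 1) (by omega)
  omega

end Walk

theorem SimpleGraph.isAcyclic_of_injective_covBy {V α : Type*} [LinearOrder α]
    (H : SimpleGraph V) (p : V → α) (hp : Function.Injective p)
    (hcov : ∀ v w, H.Adj v w → p v < p w → ∀ u, p v < p u → p w ≤ p u) : H.IsAcyclic := by
  rw [SimpleGraph.isAcyclic_iff_forall_adj_isBridge]
  have key : ∀ v w, H.Adj v w → p v < p w → H.IsBridge s(v, w) := by
    intro v w hvw hlt
    rw [SimpleGraph.isBridge_iff]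
    rintro ⟨q⟩
    suffices h : ∀ x y, (H \ SimpleGraph.fromEdgeSet {s(v, w)}).Walk x y → p x ≤ p v → p y ≤ p v from
      (h v w q le_rfl).not_gt hlt
    intro x y q
    induction q with
    | nil => exact id
    | @cons x z y hxz q ih =>
      refine fun hx => ih (le_of_not_gt fun hz => ?_)
      have hadj : H.Adj x z := hxz.1
      obtain rfl : x = v := hp (hx.antisymm (le_of_not_gt fun h =>
        (hcov x z hadj (hx.trans_lt hz) v h).not_gt hz))
      obtain rfl : z = w := hp (le_antisymm (hcov x z hadj hz w hlt) (hcov x w hvw hlt z hz))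
      exact hxz.2 (by simp [hadj.ne])
  intro v w h
  rcases lt_trichotomy (p v) (p w) with hlt | heq | hlt
  · exact key v w h hlt
  · exact absurd (hp heq) h.ne
  · rw [Sym2.eq_swap]
    exact key w v h.symm hlt

theorem acyclic (n : ℕ) (μ : ZMod (2*n+1) → ℤ)
    (hn : 0 < n)
    (hval : ∀ v, μ v = 1 ∨ μ v = -1)
    (hplus : (Finset.univ.filter fun v : ZMod (2*n+1) => μ v = 1).card = n + 1)
    (hminus : (Finset.univ.filter fun v : ZMod (2*n+1) => μ v = -1).card = n) :
    (G n μ).IsAcyclic := by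
  have hsum : ∑ v, μ v = 1 := by
    rw [sum_eq_card_sub_card _ _ hval, hplus, hminus]
    push_cast
    ring
  refine SimpleGraph.isAcyclic_of_injective_covBy _ (position n μ) position_injective ?_
  intro v w hadj hlt
  rw [G, SimpleGraph.fromRel_adj] at hadj
  rcases hadj.2 with ⟨hm, hA | hB⟩ | ⟨hm, hA | hB⟩
  · exact (hA.position_covBy hval hsum hm).2
  · exact absurd (hB.position_covBy hval hsum hm).1 hlt.not_gt
  · exact absurd (hA.position_covBy hval hsum hm).1 hlt.not_gt
  · exact (hB.position_covBy hval hsum hm).2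
end
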